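/- arXiv:2402.05444 — 7 statements merged into one kernel-verified Lean document; each statement's English description precedes it below -/
import Mathlib

section
/- Let 𝓑 ⊆ ℕⁿ be a finite set and 𝒮 ⊆ ℕⁿ a set such that 2𝓑 := {2β : β ∈ 𝓑} ⊆ 𝒮, and assume that for all β, γ ∈ 𝓑 with (β)₂ = (γ)₂ one has β + γ ∈ 2𝓑. Define a symmetric relation R on 𝓑 by β R γ iff β + γ ∈ 𝒮, and a symmetric relation R' on (𝓑)₂ by δ R' σ iff (𝓑_δ + 𝓑_σ) ∩ 𝒮 ≠ ∅. Then for all β, γ ∈ 𝓑: (β,γ) lies in the transitive closure of R if and only if ((β)₂,(γ)₂) lies in the transitive closure of R'. Consequently, the block closure of the matrix C indexed by 𝓑 with C_{βγ} = 1 iff β + γ ∈ 𝒮 satisfies B̄_{βγ} = B̄'_{(β)₂(γ)₂}, where B̄' is the block closure of the matrix indexed by (𝓑)₂ with entries [C']_{δσ} = 1 iff (𝓑_δ + 𝓑_σ) ∩ 𝒮 ≠ ∅. -/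
open scoped Classical

/-- The parity type `(α)₂ ∈ {0,1}ⁿ` of an exponent vector `α ∈ ℕⁿ`. -/
def parityType {n : ℕ} (α : Fin n → ℕ) : Fin n → ℕ := fun i => α i % 2

/-- Lemma 3.1: Let `𝓑 ⊆ ℕⁿ` be a finite set and `𝒮 ⊆ ℕⁿ` a set
with `2𝓑 ⊆ 𝒮`, and assume that for all `β, γ ∈ 𝓑` with `(β)₂ = (γ)₂` one has
`β + γ ∈ 2𝓑`.  Define `R` on `𝓑` by `β R γ ↔ β + γ ∈ 𝒮` and `R'` on `(𝓑)₂` by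
`δ R' σ ↔ (𝓑_δ + 𝓑_σ) ∩ 𝒮 ≠ ∅`.  Then for all `β, γ ∈ 𝓑`, `(β,γ)` lies in the
transitive closure of `R` iff `((β)₂,(γ)₂)` lies in the transitive closure of
`R'`; consequently the block closures satisfy `B̄_{βγ} = B̄'_{(β)₂(γ)₂}`. -/
theorem stmt_1 {n : ℕ} (𝓑 : Finset (Fin n → ℕ)) (𝒮 : Set (Fin n → ℕ))
    (h2B : ∀ β ∈ 𝓑, (2 • β : Fin n → ℕ) ∈ 𝒮)
    (hpar : ∀ β ∈ 𝓑, ∀ γ ∈ 𝓑, parityType β = parityType γ →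
      ∃ μ ∈ 𝓑, β + γ = 2 • μ)
    (R : {x // x ∈ 𝓑} → {x // x ∈ 𝓑} → Prop)
    (hRdef : ∀ β γ : {x // x ∈ 𝓑}, R β γ ↔ (β : Fin n → ℕ) + γ ∈ 𝒮)
    (R' : {δ : Fin n → ℕ // ∃ α ∈ 𝓑, parityType α = δ} →
          {δ : Fin n → ℕ // ∃ α ∈ 𝓑, parityType α = δ} → Prop)
    (hR'def : ∀ δ σ : {δ : Fin n → ℕ // ∃ α ∈ 𝓑, parityType α = δ},
      R' δ σ ↔ ∃ β ∈ 𝓑, ∃ γ ∈ 𝓑,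
        parityType β = (δ : Fin n → ℕ) ∧ parityType γ = (σ : Fin n → ℕ) ∧
          β + γ ∈ 𝒮) :
    ∀ β γ : {x // x ∈ 𝓑},
      (Relation.TransGen R β γ ↔
        Relation.TransGen R'
          ⟨parityType (β : Fin n → ℕ), ⟨(β : Fin n → ℕ), β.2, rfl⟩⟩
          ⟨parityType (γ : Fin n → ℕ), ⟨(γ : Fin n → ℕ), γ.2, rfl⟩⟩) ∧
      ((if Relation.TransGen R β γ then (1 : ℕ) else 0) =
        (if Relation.TransGen R'
            ⟨parityType (β : Fin n → ℕ), ⟨(β : Fin n → ℕ), β.2, rfl⟩⟩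
            ⟨parityType (γ : Fin n → ℕ), ⟨(γ : Fin n → ℕ), γ.2, rfl⟩⟩
          then (1 : ℕ) else 0)) := by
  have same_parity : ∀ β γ : {x // x ∈ 𝓑}, parityType (β : Fin n → ℕ) = parityType (γ : Fin n → ℕ) →
      R β γ := by
    intro β γ h
    obtain ⟨μ, hμ, e⟩ := hpar β β.2 γ γ.2 h
    rw [hRdef, e]
    exact h2B μ hμ
  have step : ∀ δ σ, R' δ σ → ∀ β γ : {x // x ∈ 𝓑}, parityType (β : Fin n → ℕ) = δ →
      parityType (γ : Fin n → ℕ) = σ → Relation.TransGen R β γ := by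
    intro δ σ h β γ hβ hγ
    obtain ⟨b, hb, c, hc, hbδ, hcσ, hbc⟩ := (hR'def δ σ).1 h
    exact ((Relation.TransGen.single (same_parity β ⟨b, hb⟩ (hβ.trans hbδ.symm))).tail
      ((hRdef ⟨b, hb⟩ ⟨c, hc⟩).2 hbc)).tail (same_parity ⟨c, hc⟩ γ (hcσ.trans hγ.symm))
  have lift : ∀ δ σ, Relation.TransGen R' δ σ → ∀ β γ : {x // x ∈ 𝓑},
      parityType (β : Fin n → ℕ) = δ → parityType (γ : Fin n → ℕ) = σ →
      Relation.TransGen R β γ := by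
    intro δ σ h
    induction h with
    | single h => exact step _ _ h
    | @tail τ _ _ h ih =>
      intro β γ hβ hγ
      obtain ⟨a, ha, haτ⟩ := τ.2
      exact (ih β ⟨a, ha⟩ hβ haτ).trans (step _ _ h ⟨a, ha⟩ γ haτ hγ)
  intro β γ
  have key : Relation.TransGen R β γ ↔
      Relation.TransGen R'
        ⟨parityType (β : Fin n → ℕ), ⟨(β : Fin n → ℕ), β.2, rfl⟩⟩
        ⟨parityType (γ : Fin n → ℕ), ⟨(γ : Fin n → ℕ), γ.2, rfl⟩⟩ :=
    ⟨fun h => Relation.TransGen.lift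
      (fun x : {x // x ∈ 𝓑} => ⟨parityType (x : Fin n → ℕ), ⟨(x : Fin n → ℕ), x.2, rfl⟩⟩)
      (fun a b hab => (hR'def _ _).2 ⟨a, a.2, b, b.2, rfl, rfl, (hRdef a b).1 hab⟩) _ _ h,
    fun h => lift _ _ h β γ rfl rfl⟩
  exact ⟨key, by simp only [key]⟩
end

section
/- Let 𝓑 ⊆ ℕⁿ and T ⊆ ℕⁿ be finite sets and 𝒮 ⊆ ℕⁿ a set such that for all β, γ ∈ 𝓑 with (β)₂ = (γ)₂ one has (T + {β + γ}) ∩ 𝒮 ≠ ∅. Define a symmetric relation R on 𝓑 by β R γ iff (T + {β + γ}) ∩ 𝒮 ≠ ∅, and a symmetric relation R' on (𝓑)₂ by δ R' σ iff (T + 𝓑_δ + 𝓑_σ) ∩ 𝒮 ≠ ∅. Then for all β, γ ∈ 𝓑: (β,γ) lies in the transitive closure of R if and only if ((β)₂,(γ)₂) lies in the transitive closure of R'. -/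
/-- Lemma 3.2: Let `𝓑, T ⊆ ℕⁿ` be finite sets and `𝒮 ⊆ ℕⁿ` a
set such that for all `β, γ ∈ 𝓑` with `(β)₂ = (γ)₂` one has
`(T + {β + γ}) ∩ 𝒮 ≠ ∅`.  Define `R` on `𝓑` by `β R γ ↔ (T + {β+γ}) ∩ 𝒮 ≠ ∅`
and `R'` on `(𝓑)₂` by `δ R' σ ↔ (T + 𝓑_δ + 𝓑_σ) ∩ 𝒮 ≠ ∅`.  Then for all
`β, γ ∈ 𝓑`, `(β,γ)` lies in the transitive closure of `R` iff
`((β)₂,(γ)₂)` lies in the transitive closure of `R'`. -/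
theorem stmt_2 {n : ℕ} (𝓑 T : Finset (Fin n → ℕ)) (𝒮 : Set (Fin n → ℕ))
    (hpar : ∀ β ∈ 𝓑, ∀ γ ∈ 𝓑, parityType β = parityType γ →
      ∃ t ∈ T, t + (β + γ) ∈ 𝒮)
    (R : {x // x ∈ 𝓑} → {x // x ∈ 𝓑} → Prop)
    (hRdef : ∀ β γ : {x // x ∈ 𝓑},
      R β γ ↔ ∃ t ∈ T, t + ((β : Fin n → ℕ) + γ) ∈ 𝒮)
    (R' : {δ : Fin n → ℕ // ∃ α ∈ 𝓑, parityType α = δ} →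
          {δ : Fin n → ℕ // ∃ α ∈ 𝓑, parityType α = δ} → Prop)
    (hR'def : ∀ δ σ : {δ : Fin n → ℕ // ∃ α ∈ 𝓑, parityType α = δ},
      R' δ σ ↔ ∃ t ∈ T, ∃ β ∈ 𝓑, ∃ γ ∈ 𝓑,
        parityType β = (δ : Fin n → ℕ) ∧ parityType γ = (σ : Fin n → ℕ) ∧
          t + (β + γ) ∈ 𝒮) :
    ∀ β γ : {x // x ∈ 𝓑},
      Relation.TransGen R β γ ↔
        Relation.TransGen R'
          ⟨parityType (β : Fin n → ℕ), ⟨(β : Fin n → ℕ), β.2, rfl⟩⟩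
          ⟨parityType (γ : Fin n → ℕ), ⟨(γ : Fin n → ℕ), γ.2, rfl⟩⟩ := by
  have same : ∀ β γ : {x // x ∈ 𝓑},
      parityType (β : Fin n → ℕ) = parityType (γ : Fin n → ℕ) → R β γ :=
    fun β γ h => (hRdef β γ).2 (hpar β β.2 γ γ.2 h)
  intro β γ
  constructor
  · intro h
    refine Relation.TransGen.lift
      (fun α : {x // x ∈ 𝓑} =>
        (⟨parityType (α : Fin n → ℕ), ⟨(α : Fin n → ℕ), α.2, rfl⟩⟩ :
          {δ : Fin n → ℕ // ∃ α ∈ 𝓑, parityType α = δ})) ?_ _ _ h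
    intro a b hab
    obtain ⟨t, ht, hS⟩ := (hRdef a b).1 hab
    exact (hR'def _ _).2 ⟨t, ht, a, a.2, b, b.2, rfl, rfl, hS⟩
  · intro h
    have key : ∀ σ, Relation.TransGen R'
        ⟨parityType (β : Fin n → ℕ), ⟨(β : Fin n → ℕ), β.2, rfl⟩⟩ σ →
        ∀ α : {x // x ∈ 𝓑}, parityType (α : Fin n → ℕ) = σ →
          Relation.TransGen R β α := by
      intro σ hσ
      induction hσ with
      | single h =>
        intro α hα
        obtain ⟨t, ht, b, hb, c, hc, hbδ, hcσ, hS⟩ := (hR'def _ _).1 h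
        exact ((Relation.TransGen.single (same β ⟨b, hb⟩ hbδ.symm)).tail
          ((hRdef ⟨b, hb⟩ ⟨c, hc⟩).2 ⟨t, ht, hS⟩)).tail
            (same ⟨c, hc⟩ α (hcσ.trans hα.symm))
      | tail _ h ih =>
        intro α hα
        obtain ⟨t, ht, b, hb, c, hc, hbδ, hcσ, hS⟩ := (hR'def _ _).1 h
        exact ((ih ⟨b, hb⟩ hbδ).tail
          ((hRdef ⟨b, hb⟩ ⟨c, hc⟩).2 ⟨t, ht, hS⟩)).tail
            (same ⟨c, hc⟩ α (hcσ.trans hα.symm))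
    exact key _ h γ rfl
end

section
/- Let 𝓑 ⊆ ℕⁿ be a finite set with 0 ∈ 𝓑, let f = Σ_α f_α x^α be a real polynomial with supp(f) ⊆ 𝓑 + 𝓑, let B^(k) be a symmetric binary matrix indexed by 𝓑, and let B^(τ) be a symmetric binary matrix indexed by 𝓑 that is the pattern of a partition of 𝓑 and satisfies supp(B^(τ)) ⊆ supp(B^(k)). For a binary matrix B indexed by 𝓑, let F_B := {y : ℕⁿ → ℝ : y_0 = 1 and B ∘ M_𝓑(y) is positive semidefinite}. Then F_{B^(k)} ⊆ F_{B^(τ)}; consequently, if F_{B^(k)} is nonempty and {L_y(f) : y ∈ F_{B^(τ)}} is bounded below, then θ_τ := inf{L_y(f) : y ∈ F_{B^(τ)}} ≤ inf{L_y(f) : y ∈ F_{B^(k)}} =: θ_k. -/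
open scoped Classical

/-- The moment matrix `M_𝓑(y)` with entries `M_𝓑(y)_{βγ} = y_{β+γ}`. -/
noncomputable def momentMatrix {n : ℕ} (𝓑 : Finset (Fin n → ℕ))
    (y : (Fin n → ℕ) → ℝ) : Matrix {x // x ∈ 𝓑} {x // x ∈ 𝓑} ℝ :=
  Matrix.of fun β γ => y ((β : Fin n → ℕ) + γ)

/-- The feasible set `F_B = {y : y_0 = 1, B ∘ M_𝓑(y) PSD}` of the block
moment problem associated with a binary matrix `B` indexed by `𝓑`. -/
noncomputable def momentFeas {n : ℕ} (𝓑 : Finset (Fin n → ℕ))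
    (B : Matrix {x // x ∈ 𝓑} {x // x ∈ 𝓑} ℝ) : Set ((Fin n → ℕ) → ℝ) :=
  {y | y 0 = 1 ∧ (Matrix.hadamard B (momentMatrix 𝓑 y)).PosSemidef}

/-- The Riesz functional `L_y(f) = Σ_α f_α y_α`. -/
noncomputable def riesz {n : ℕ} (f : (Fin n → ℕ) →₀ ℝ)
    (y : (Fin n → ℕ) → ℝ) : ℝ :=
  ∑ α ∈ f.support, f α * y α

/-- The 0-1 matrix of an equivalence relation is positive semidefinite. -/
theorem posSemidef_setoidPattern {ι : Type*} (s : Setoid ι) :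
    (Matrix.of fun i j => if s.r i j then (1 : ℝ) else 0).PosSemidef := by
  have h : (Matrix.of fun i j => if s.r i j then (1 : ℝ) else 0) =
      (1 : Matrix (Quotient s) (Quotient s) ℝ).submatrix (Quotient.mk s) (Quotient.mk s) := by
    ext i j
    simp only [Matrix.of_apply, Matrix.submatrix_apply, Matrix.one_apply, Quotient.eq]
  rw [h]
  exact Matrix.PosSemidef.one.submatrix _

/-- Lemma 4.2: Let `𝓑 ⊆ ℕⁿ` be finite with `0 ∈ 𝓑`, let `f` be
a polynomial with `supp(f) ⊆ 𝓑 + 𝓑`, let `B^(k)` be a symmetric binary matrix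
indexed by `𝓑` and `B^(τ)` a symmetric binary matrix indexed by `𝓑` that is
the pattern of a partition of `𝓑` with `supp(B^(τ)) ⊆ supp(B^(k))`.  Then
`F_{B^(k)} ⊆ F_{B^(τ)}`; consequently, if `F_{B^(k)}` is nonempty and
`{L_y(f) : y ∈ F_{B^(τ)}}` is bounded below, then
`θ_τ = inf{L_y(f) : y ∈ F_{B^(τ)}} ≤ inf{L_y(f) : y ∈ F_{B^(k)}} = θ_k`. -/
theorem stmt_8 {n : ℕ} (𝓑 : Finset (Fin n → ℕ)) (h0 : (0 : Fin n → ℕ) ∈ 𝓑)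
    (f : (Fin n → ℕ) →₀ ℝ)
    (hsupp : ∀ α ∈ f.support, ∃ β ∈ 𝓑, ∃ γ ∈ 𝓑, α = β + γ)
    (Bk Bτ : Matrix {x // x ∈ 𝓑} {x // x ∈ 𝓑} ℝ)
    (hBksym : Bk.IsSymm) (hBkbin : ∀ β γ, Bk β γ = 0 ∨ Bk β γ = 1)
    (s : Setoid {x // x ∈ 𝓑})
    (hBτ : ∀ β γ, Bτ β γ = if s.r β γ then 1 else 0)
    (hsub : ∀ β γ, Bτ β γ = 1 → Bk β γ = 1) :
    momentFeas 𝓑 Bk ⊆ momentFeas 𝓑 Bτ ∧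
    ((momentFeas 𝓑 Bk).Nonempty →
      BddBelow (riesz f '' momentFeas 𝓑 Bτ) →
      sInf (riesz f '' momentFeas 𝓑 Bτ) ≤ sInf (riesz f '' momentFeas 𝓑 Bk)) := by
  have hpsd : Bτ.PosSemidef := by
    have hB : Bτ = Matrix.of fun β γ => if s.r β γ then (1 : ℝ) else 0 := by
      ext β γ
      exact hBτ β γ
    exact hB ▸ posSemidef_setoidPattern s
  have hmask : Matrix.hadamard Bτ Bk = Bτ := by
    ext β γ
    have hβγ := hBτ β γ
    rw [Matrix.hadamard_apply]
    split_ifs at hβγ with h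
    · rw [hsub β γ hβγ, mul_one]
    · rw [hβγ, zero_mul]
  have hfeas : momentFeas 𝓑 Bk ⊆ momentFeas 𝓑 Bτ := by
    rintro y ⟨hy, hpos⟩
    refine ⟨hy, ?_⟩
    rw [← hmask, Matrix.hadamard_assoc]
    exact hpsd.hadamard hpos
  exact ⟨hfeas, fun hne hbdd => csInf_le_csInf hbdd (hne.image _) (Set.image_mono hfeas)⟩
end

section
/- Let 𝓑 ⊆ ℕⁿ be a finite set with 0 ∈ 𝓑, let B be a symmetric binary matrix indexed by 𝓑, and let f = Σ_α f_α x^α be a real polynomial. Suppose λ ∈ ℝ and Q is a real positive semidefinite matrix indexed by 𝓑 with B ∘ Q = Q such that the coefficient identity f − λ = Σ_{β,γ ∈ 𝓑} Q_{βγ} x^{β+γ} holds. Then for every y : ℕⁿ → ℝ with y_0 = 1 and B ∘ M_𝓑(y) positive semidefinite, one has λ ≤ L_y(f). -/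
open scoped Classical

theorem Matrix.PosSemidef.sum_entries_nonneg {ι : Type*} [Fintype ι] {A : Matrix ι ι ℝ}
    (hA : A.PosSemidef) : 0 ≤ ∑ i, ∑ j, A i j := by
  simpa [dotProduct, Matrix.mulVec] using hA.dotProduct_mulVec_nonneg 1

theorem riesz_eq_sum_of_support_subset {n : ℕ} {f : (Fin n → ℕ) →₀ ℝ}
    {s : Finset (Fin n → ℕ)} (hs : f.support ⊆ s) (y : (Fin n → ℕ) → ℝ) :
    riesz f y = ∑ α ∈ s, f α * y α :=
  Finset.sum_subset hs fun α _ hα => by simp [Finsupp.notMem_support_iff.mp hα]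

/-- The Riesz functional turns the Gram identity into a pairing of `Q` with the moment matrix. -/
theorem riesz_sub_eq_sum_mul_momentMatrix {n : ℕ} (𝓑 : Finset (Fin n → ℕ))
    (f : (Fin n → ℕ) →₀ ℝ) (lam : ℝ) (Q : Matrix {x // x ∈ 𝓑} {x // x ∈ 𝓑} ℝ)
    (hGram : ∀ α : Fin n → ℕ,
      f α - (if α = 0 then lam else 0) =
        ∑ β : {x // x ∈ 𝓑}, ∑ γ : {x // x ∈ 𝓑},
          if (β : Fin n → ℕ) + γ = α then Q β γ else 0)
    (y : (Fin n → ℕ) → ℝ) :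
    riesz f y - lam * y 0 = ∑ β, ∑ γ, Q β γ * momentMatrix 𝓑 y β γ := by
  let s : Finset (Fin n → ℕ) :=
    insert 0 (f.support ∪ Finset.univ.image
      fun p : {x // x ∈ 𝓑} × {x // x ∈ 𝓑} => (p.1 : Fin n → ℕ) + p.2)
  have hf : f.support ⊆ s := fun α hα =>
    Finset.mem_insert_of_mem (Finset.mem_union_left _ hα)
  have h0 : (0 : Fin n → ℕ) ∈ s := Finset.mem_insert_self _ _
  have hadd (β γ : {x // x ∈ 𝓑}) : (β : Fin n → ℕ) + γ ∈ s :=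
    Finset.mem_insert_of_mem (Finset.mem_union_right _
      (Finset.mem_image_of_mem _ (Finset.mem_univ (β, γ))))
  calc
    riesz f y - lam * y 0 = ∑ α ∈ s, (f α - if α = 0 then lam else 0) * y α := by
      simp [riesz_eq_sum_of_support_subset hf, sub_mul, Finset.sum_sub_distrib, ite_mul, h0]
    _ = ∑ α ∈ s, ∑ β : {x // x ∈ 𝓑}, ∑ γ : {x // x ∈ 𝓑},
          if (β : Fin n → ℕ) + γ = α then Q β γ * y α else 0 := by
      simp only [hGram, Finset.sum_mul, ite_mul, zero_mul]
    _ = ∑ β, ∑ γ, Q β γ * momentMatrix 𝓑 y β γ := by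
      rw [Finset.sum_comm]
      refine Finset.sum_congr rfl fun β _ => ?_
      rw [Finset.sum_comm]
      refine Finset.sum_congr rfl fun γ _ => ?_
      rw [Finset.sum_ite_eq, if_pos (hadd β γ)]
      rfl

/-- weak duality: Let `𝓑 ⊆ ℕⁿ` be finite with `0 ∈ 𝓑`, `B` a
symmetric binary matrix indexed by `𝓑`, and `f` a polynomial.  Suppose
`λ ∈ ℝ` and `Q` is PSD with `B ∘ Q = Q` and the coefficient identity
`f − λ = Σ_{β,γ ∈ 𝓑} Q_{βγ} x^{β+γ}` holds.  Then for every `y` with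
`y_0 = 1` and `B ∘ M_𝓑(y)` PSD, one has `λ ≤ L_y(f)`. -/
theorem stmt_9 {n : ℕ} (𝓑 : Finset (Fin n → ℕ)) (h0 : (0 : Fin n → ℕ) ∈ 𝓑)
    (B : Matrix {x // x ∈ 𝓑} {x // x ∈ 𝓑} ℝ)
    (hBsym : B.IsSymm) (hBbin : ∀ β γ, B β γ = 0 ∨ B β γ = 1)
    (f : (Fin n → ℕ) →₀ ℝ) (lam : ℝ)
    (Q : Matrix {x // x ∈ 𝓑} {x // x ∈ 𝓑} ℝ)
    (hQ : Q.PosSemidef) (hBQ : Matrix.hadamard B Q = Q)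
    (hGram : ∀ α : Fin n → ℕ,
      f α - (if α = 0 then lam else 0) =
        ∑ β : {x // x ∈ 𝓑}, ∑ γ : {x // x ∈ 𝓑},
          if (β : Fin n → ℕ) + γ = α then Q β γ else 0)
    (y : (Fin n → ℕ) → ℝ) (hy0 : y 0 = 1)
    (hyPSD : (Matrix.hadamard B (momentMatrix 𝓑 y)).PosSemidef) :
    lam ≤ riesz f y := by
  have hpair := riesz_sub_eq_sum_mul_momentMatrix 𝓑 f lam Q hGram y
  have hnonneg := (hQ.hadamard hyPSD).sum_entries_nonneg
  have hentry (β γ : {x // x ∈ 𝓑}) :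
      Matrix.hadamard Q (Matrix.hadamard B (momentMatrix 𝓑 y)) β γ =
        Q β γ * momentMatrix 𝓑 y β γ := by
    have h : B β γ * Q β γ = Q β γ := congrFun (congrFun hBQ β) γ
    simp only [Matrix.hadamard_apply]
    rw [← mul_assoc, mul_comm (Q β γ), h]
  simp only [hentry] at hnonneg
  rw [hy0, mul_one] at hpair
  linarith
end

section
/- Let 𝓑 ⊆ ℕⁿ be a finite set, 𝒜 ⊆ ℕⁿ a finite set, and define the TSSOS recursion: 𝒮^(0) := 𝒜 ∪ 2𝓑 where 2𝓑 := {2β : β ∈ 𝓑}; for k ≥ 1, C^(k) is the symmetric binary matrix indexed by 𝓑 with C^(k)_{βγ} = 1 iff β + γ ∈ 𝒮^(k−1); B^(k) is the block closure of C^(k); and 𝒮^(k) := {β + γ : B^(k)_{βγ} = 1}. Then for every k ≥ 1, supp(B^(k)) ⊆ supp(B^(k+1)). -/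
/-- TSSOS recursion.  With `𝒮^(0) = 𝒜 ∪ 2𝓑`, and for `k ≥ 1`,
`C^(k)_{βγ} = 1 ↔ β + γ ∈ 𝒮^(k−1)`, `B^(k)` the block closure (transitive
closure) of `C^(k)`, and `𝒮^(k) = {β + γ : B^(k)_{βγ} = 1}`, one has
`supp(B^(k)) ⊆ supp(B^(k+1))` for every `k ≥ 1`. -/
theorem stmt_12 {n : ℕ} (𝓑 𝒜 : Finset (Fin n → ℕ))
    (S : ℕ → Set (Fin n → ℕ))
    (Bk : ℕ → ({x // x ∈ 𝓑} → {x // x ∈ 𝓑} → Prop))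
    (hS0 : S 0 = ↑𝒜 ∪ {α | ∃ β ∈ 𝓑, α = 2 • β})
    (hBk : ∀ k : ℕ, Bk (k + 1) =
      Relation.TransGen (fun β γ : {x // x ∈ 𝓑} => (β : Fin n → ℕ) + γ ∈ S k))
    (hSk : ∀ k : ℕ, S (k + 1) =
      {α | ∃ β γ : {x // x ∈ 𝓑}, Bk (k + 1) β γ ∧ α = (β : Fin n → ℕ) + γ}) :
    ∀ k : ℕ, 1 ≤ k → ∀ β γ : {x // x ∈ 𝓑}, Bk k β γ → Bk (k + 1) β γ := by
  rintro (_ | k) hk β γ h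
  · omega
  · rw [hBk k] at h
    rw [hBk (k + 1)]
    refine Relation.TransGen.mono (fun a b hab => ?_) _ _ h
    rw [hSk k]
    exact ⟨a, b, by rw [hBk k]; exact .single hab, rfl⟩
end

section
/- Let 𝓑 ⊆ ℕⁿ be a finite set, 𝒜 ⊆ ℕⁿ a finite set, and define the TSSOS recursion: 𝒮^(0) := 𝒜 ∪ 2𝓑 where 2𝓑 := {2β : β ∈ 𝓑}; for k ≥ 1, C^(k) is the symmetric binary matrix indexed by 𝓑 with C^(k)_{βγ} = 1 iff β + γ ∈ 𝒮^(k−1); B^(k) is the block closure of C^(k); and 𝒮^(k) := {β + γ : B^(k)_{βγ} = 1}. Then the sequence (B^(k))_{k ≥ 1} stabilizes after finitely many steps: there exists N ≥ 1 such that B^(k) = B^(N) for all k ≥ N. -/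
/-- TSSOS recursion.  With `𝒮^(0) = 𝒜 ∪ 2𝓑`, and for `k ≥ 1`,
`C^(k)_{βγ} = 1 ↔ β + γ ∈ 𝒮^(k−1)`, `B^(k)` the block closure (transitive
closure) of `C^(k)`, and `𝒮^(k) = {β + γ : B^(k)_{βγ} = 1}`, the sequence
`(B^(k))_{k ≥ 1}` stabilizes after finitely many steps. -/
theorem stmt_13 {n : ℕ} (𝓑 𝒜 : Finset (Fin n → ℕ))
    (S : ℕ → Set (Fin n → ℕ))
    (Bk : ℕ → ({x // x ∈ 𝓑} → {x // x ∈ 𝓑} → Prop))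
    (hS0 : S 0 = ↑𝒜 ∪ {α | ∃ β ∈ 𝓑, α = 2 • β})
    (hBk : ∀ k : ℕ, Bk (k + 1) =
      Relation.TransGen (fun β γ : {x // x ∈ 𝓑} => (β : Fin n → ℕ) + γ ∈ S k))
    (hSk : ∀ k : ℕ, S (k + 1) =
      {α | ∃ β γ : {x // x ∈ 𝓑}, Bk (k + 1) β γ ∧ α = (β : Fin n → ℕ) + γ}) :
    ∃ N : ℕ, 1 ≤ N ∧ ∀ k : ℕ, N ≤ k → Bk k = Bk N := by
  have hmono : Monotone fun k => Bk (k + 1) := by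
    refine monotone_nat_of_le_succ fun k β γ h => ?_
    rw [hBk (k + 1)]
    refine .single ?_
    rw [hSk k]
    exact ⟨β, γ, h, rfl⟩
  obtain ⟨m, hm⟩ := WellFoundedGT.monotone_chain_condition ⟨fun k => Bk (k + 1), hmono⟩
  refine ⟨m + 1, Nat.le_add_left 1 m, fun k hk => ?_⟩
  obtain ⟨j, rfl⟩ := Nat.exists_eq_add_of_le' (Nat.le_of_add_left_le hk)
  exact (hm j (Nat.le_of_succ_le_succ hk)).symm
end

section
/- Let 𝓑 ⊆ ℕⁿ be a finite set with 0 ∈ 𝓑, let B be a symmetric binary matrix indexed by 𝓑 that is the pattern of a partition of 𝓑, and let f = Σ_α f_α x^α be a real polynomial with supp(f) ⊆ 𝓑 + 𝓑. Define Λ := {λ ∈ ℝ : ∃ Q positive semidefinite indexed by 𝓑 with B ∘ Q = Q and f − λ = Σ_{β,γ ∈ 𝓑} Q_{βγ} x^{β+γ}} and θ := inf{L_y(f) : y : ℕⁿ → ℝ, y_0 = 1, B ∘ M_𝓑(y) positive semidefinite}. If Λ is nonempty, then Λ attains its supremum (the sparse SOS program (P^τ)* is solvable) and sup Λ = θ (there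 is no duality gap between (P^τ) and (P^τ)*). -/
open scoped Classical

/-- The feasible set `Λ` of the sparse SOS program `(P^τ)*`: the set of
`λ ∈ ℝ` admitting a PSD Gram matrix `Q` with `B ∘ Q = Q` and
`f − λ = Σ_{β,γ ∈ 𝓑} Q_{βγ} x^{β+γ}`. -/
noncomputable def sosSet {n : ℕ} (𝓑 : Finset (Fin n → ℕ))
    (f : (Fin n → ℕ) →₀ ℝ) (B : Matrix {x // x ∈ 𝓑} {x // x ∈ 𝓑} ℝ) :
    Set ℝ :=
  {lam | ∃ Q : Matrix {x // x ∈ 𝓑} {x // x ∈ 𝓑} ℝ, Q.PosSemidef ∧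
    Matrix.hadamard B Q = Q ∧
    ∀ α : Fin n → ℕ,
      f α - (if α = 0 then lam else 0) =
        ∑ β : {x // x ∈ 𝓑}, ∑ γ : {x // x ∈ 𝓑},
          if (β : Fin n → ℕ) + γ = α then Q β γ else 0}

open scoped Matrix Matrix.Norms.Elementwise

/-- The image of a closed cone under a continuous linear map that vanishes on the cone only at the
origin is closed. Vanishing is detected by a continuous seminorm on the codomain. -/
theorem isClosed_image_of_seminorm_eq_zero {E F : Type*} [NormedAddCommGroup E] [NormedSpace ℝ E]
    [ProperSpace E] [AddCommGroup F] [Module ℝ F] [TopologicalSpace F] [T2Space F]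
    (A : E →L[ℝ] F) (p : Seminorm ℝ F) (hp : Continuous p) {K : Set E} (hK : IsClosed K)
    (hsmul : ∀ c : ℝ, 0 < c → ∀ x ∈ K, c • x ∈ K)
    (hker : ∀ x ∈ K, p (A x) = 0 → x = 0) : IsClosed (A '' K) := by
  obtain ⟨c, hc, hbound⟩ : ∃ c : ℝ, 0 < c ∧ ∀ x ∈ K, c * ‖x‖ ≤ p (A x) := by
    have hS : IsCompact (K ∩ Metric.sphere 0 1) := (isCompact_sphere 0 1).inter_left hK
    have hmem : ∀ x ∈ K, x ≠ 0 → ‖x‖⁻¹ • x ∈ K ∩ Metric.sphere 0 1 := fun x hx hx0 =>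
      ⟨hsmul _ (inv_pos.2 (norm_pos_iff.2 hx0)) x hx, by simp [norm_smul, hx0]⟩
    rcases (K ∩ Metric.sphere 0 1).eq_empty_or_nonempty with he | hne
    · refine ⟨1, one_pos, fun x hx => ?_⟩
      by_cases hx0 : x = 0
      · simp [hx0]
      · exact absurd (hmem x hx hx0) (he ▸ Set.notMem_empty _)
    · obtain ⟨z, hz, hmin⟩ := hS.exists_isMinOn hne (hp.comp A.continuous).continuousOn
      refine ⟨p (A z), lt_of_le_of_ne (apply_nonneg p _) fun h => ?_, fun x hx => ?_⟩
      · have := hker z hz.1 h.symm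
        simpa [this] using hz.2
      · by_cases hx0 : x = 0
        · simp [hx0]
        · have h := hmin (hmem x hx hx0)
          simp only [Set.mem_ofPred_eq, Function.comp_apply, map_smul, map_smul_eq_mul, norm_inv,
            norm_norm] at h
          rwa [inv_mul_eq_div, le_div_iff₀ (norm_pos_iff.2 hx0)] at h
  refine isClosed_of_closure_subset fun g hg => ?_
  let U : Set F := {g' | p g' < p g + 1}
  have hU : IsOpen U := isOpen_lt hp continuous_const
  have hsub : U ∩ A '' K ⊆ A '' (K ∩ Metric.closedBall 0 ((p g + 1) / c)) := by
    rintro _ ⟨hxU, x, hx, rfl⟩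
    refine ⟨x, ⟨hx, ?_⟩, rfl⟩
    rw [mem_closedBall_zero_iff, le_div_iff₀' hc]
    exact (hbound x hx).trans (le_of_lt hxU)
  have hclosed : IsClosed (A '' (K ∩ Metric.closedBall 0 ((p g + 1) / c))) :=
    (((isCompact_closedBall 0 _).inter_left hK).image A.continuous).isClosed
  have hgU : g ∈ U := by simp [U]
  exact Set.image_mono Set.inter_subset_left
    (closure_minimal hsub hclosed (hU.inter_closure ⟨hgU, hg⟩))

/-- The positive semidefinite matrices that are fixed by the pattern `B`. -/
def patternCone {ι : Type*} (B : Matrix ι ι ℝ) : Set (Matrix ι ι ℝ) :=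
  {Q | Q.PosSemidef ∧ B ⊙ Q = Q}

theorem isClosed_patternCone {ι : Type*} [Fintype ι] (B : Matrix ι ι ℝ) :
    IsClosed (patternCone B) := by
  have hset : patternCone B = {Q | Qᴴ = Q} ∩ (⋂ x : ι → ℝ, {Q | 0 ≤ star x ⬝ᵥ (Q *ᵥ x)}) ∩
      {Q | B ⊙ Q = Q} := by
    ext Q
    simp [patternCone, Matrix.posSemidef_iff_dotProduct_mulVec, Matrix.IsHermitian]
  rw [hset]
  refine ((isClosed_eq (by fun_prop) (by fun_prop)).inter (isClosed_iInter fun x => ?_)).inter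
    (isClosed_eq ?_ continuous_id)
  · exact isClosed_le continuous_const (by fun_prop)
  · exact continuous_matrix fun i j => by simp only [Matrix.hadamard_apply]; fun_prop

theorem smul_mem_patternCone {ι : Type*} {B Q : Matrix ι ι ℝ} (hQ : Q ∈ patternCone B) {c : ℝ}
    (hc : 0 ≤ c) : c • Q ∈ patternCone B :=
  ⟨hQ.1.smul hc, by rw [Matrix.hadamard_smul, hQ.2]⟩

theorem add_mem_patternCone {ι : Type*} {B Q R : Matrix ι ι ℝ} (hQ : Q ∈ patternCone B)
    (hR : R ∈ patternCone B) : Q + R ∈ patternCone B :=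
  ⟨hQ.1.add hR.1, by rw [Matrix.hadamard_add, hQ.2, hR.2]⟩

/-- The pattern of a partition is positive semidefinite. -/
theorem posSemidef_of_setoid {ι : Type*} [Fintype ι] (s : Setoid ι) {B : Matrix ι ι ℝ}
    (hB : ∀ i j, B i j = if s.r i j then 1 else 0) : B.PosSemidef := by
  let X : Matrix ι (Quotient s) ℝ := Matrix.of fun i c => if (⟦i⟧ : Quotient s) = c then 1 else 0
  have hX : B = X * Xᴴ := by
    ext i j
    have : (⟦i⟧ : Quotient s) = ⟦j⟧ ↔ s.r i j := Quotient.eq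
    simp [X, Matrix.mul_apply, hB, ← this, eq_comm]
  exact hX ▸ Matrix.posSemidef_self_mul_conjTranspose X

theorem Matrix.PosSemidef.sum_mul_nonneg {ι : Type*} [Fintype ι] {Q N : Matrix ι ι ℝ}
    (hQ : Q.PosSemidef) (hN : N.PosSemidef) : 0 ≤ ∑ i, ∑ j, Q i j * N i j := by
  simpa [dotProduct, Matrix.mulVec] using (hQ.hadamard hN).dotProduct_mulVec_nonneg 1

/-- The coefficients of the polynomial `Σ_{β,γ ∈ 𝓑} Q_{βγ} x^{β+γ}`. -/
noncomputable def gramCoeff {n : ℕ} (𝓑 : Finset (Fin n → ℕ)) :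
    Matrix {x // x ∈ 𝓑} {x // x ∈ 𝓑} ℝ →ₗ[ℝ] ((Fin n → ℕ) → ℝ) where
  toFun Q := ∑ β : {x // x ∈ 𝓑}, ∑ γ : {x // x ∈ 𝓑},
    Q β γ • Pi.single ((β : Fin n → ℕ) + γ) (1 : ℝ)
  map_add' Q R := by simp [add_smul, Finset.sum_add_distrib]
  map_smul' c Q := by simp [mul_smul, Finset.smul_sum]

theorem gramCoeff_eq_sum {n : ℕ} (𝓑 : Finset (Fin n → ℕ))
    (Q : Matrix {x // x ∈ 𝓑} {x // x ∈ 𝓑} ℝ) :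
    gramCoeff 𝓑 Q = ∑ β : {x // x ∈ 𝓑}, ∑ γ : {x // x ∈ 𝓑},
      Q β γ • Pi.single ((β : Fin n → ℕ) + γ) (1 : ℝ) := rfl

theorem gramCoeff_apply {n : ℕ} (𝓑 : Finset (Fin n → ℕ))
    (Q : Matrix {x // x ∈ 𝓑} {x // x ∈ 𝓑} ℝ) (α : Fin n → ℕ) :
    gramCoeff 𝓑 Q α = ∑ β : {x // x ∈ 𝓑}, ∑ γ : {x // x ∈ 𝓑},
      if (β : Fin n → ℕ) + γ = α then Q β γ else 0 := by
  simp [gramCoeff_eq_sum, Finset.sum_apply, Pi.single_apply, eq_comm]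

theorem mem_sosSet_iff {n : ℕ} {𝓑 : Finset (Fin n → ℕ)} {f : (Fin n → ℕ) →₀ ℝ}
    {B : Matrix {x // x ∈ 𝓑} {x // x ∈ 𝓑} ℝ} {lam : ℝ} :
    lam ∈ sosSet 𝓑 f B ↔
      (f : (Fin n → ℕ) → ℝ) - lam • Pi.single 0 1 ∈ gramCoeff 𝓑 '' patternCone B := by
  simp only [sosSet, Set.mem_ofPred_eq, Set.mem_image, patternCone, funext_iff, gramCoeff_apply,
    Pi.sub_apply, Pi.smul_apply, Pi.single_apply, smul_eq_mul, mul_ite, mul_one, mul_zero,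
    and_assoc, eq_comm]

/-- Applying a Riesz functional to a polynomial given by a Gram matrix. -/
theorem linearCombination_eq_of_gramCoeff {n : ℕ} {𝓑 : Finset (Fin n → ℕ)}
    {Q : Matrix {x // x ∈ 𝓑} {x // x ∈ 𝓑} ℝ} {g : (Fin n → ℕ) →₀ ℝ}
    (hg : gramCoeff 𝓑 Q = g) (y : (Fin n → ℕ) → ℝ) :
    Finsupp.linearCombination ℝ y g =
      ∑ β : {x // x ∈ 𝓑}, ∑ γ : {x // x ∈ 𝓑}, Q β γ * y ((β : Fin n → ℕ) + γ) := by
  have : g = ∑ β : {x // x ∈ 𝓑}, ∑ γ : {x // x ∈ 𝓑},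
      Finsupp.single ((β : Fin n → ℕ) + γ) (Q β γ) := by
    ext α
    rw [← hg, gramCoeff_apply]
    simp [Finsupp.finsetSum_apply, Finsupp.single_apply]
  simp [this]

theorem riesz_eq_linearCombination {n : ℕ} (f : (Fin n → ℕ) →₀ ℝ) (y : (Fin n → ℕ) → ℝ) :
    riesz f y = Finsupp.linearCombination ℝ y f := rfl

/-- Monomials with exponents in `𝓑` are linearly independent as functions. -/
theorem eq_zero_of_forall_sum_mul_prod_pow_eq_zero {n : ℕ} {𝓑 : Finset (Fin n → ℕ)}
    {a : {x // x ∈ 𝓑} → ℝ}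
    (ha : ∀ x : Fin n → ℝ, ∑ γ, a γ * ∏ i, x i ^ (γ : Fin n → ℕ) i = 0) : a = 0 := by
  let e : {x // x ∈ 𝓑} → (Fin n →₀ ℕ) := fun γ => Finsupp.equivFunOnFinite.symm γ
  have he : Function.Injective e :=
    Finsupp.equivFunOnFinite.symm.injective.comp Subtype.val_injective
  have hq : ∑ γ, MvPolynomial.monomial (e γ) (a γ) = 0 := by
    refine MvPolynomial.funext fun x => ?_
    simpa [MvPolynomial.eval_monomial, Finsupp.prod_fintype, e] using ha x
  funext γ
  simpa [MvPolynomial.coeff_sum, MvPolynomial.coeff_monomial, he.eq_iff] using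
    congrArg (MvPolynomial.coeff (e γ)) hq

/-- A sum of squares vanishes only if its Gram matrix does. -/
theorem eq_zero_of_gramCoeff_eq_zero {n : ℕ} {𝓑 : Finset (Fin n → ℕ)}
    {Q : Matrix {x // x ∈ 𝓑} {x // x ∈ 𝓑} ℝ} (hQ : Q.PosSemidef) (h : gramCoeff 𝓑 Q = 0) :
    Q = 0 := by
  have hrow : ∀ x : Fin n → ℝ, Q *ᵥ (fun γ => ∏ i, x i ^ (γ : Fin n → ℕ) i) = 0 := by
    intro x
    rw [← hQ.dotProduct_mulVec_zero_iff]
    have := linearCombination_eq_of_gramCoeff (g := 0) h fun α => ∏ i, x i ^ α i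
    rw [map_zero] at this
    rw [this]
    simp only [dotProduct, Matrix.mulVec, Finset.mul_sum, Pi.star_apply, star_trivial,
      Pi.add_apply, pow_add, Finset.prod_mul_distrib]
    exact Finset.sum_congr rfl fun β _ => Finset.sum_congr rfl fun γ _ => by ring
  ext β γ
  exact congrFun (eq_zero_of_forall_sum_mul_prod_pow_eq_zero fun x => congrFun (hrow x) β) γ

theorem isClosed_gramCoeff_image_patternCone {n : ℕ} (𝓑 : Finset (Fin n → ℕ))
    (B : Matrix {x // x ∈ 𝓑} {x // x ∈ 𝓑} ℝ) : IsClosed (gramCoeff 𝓑 '' patternCone B) := by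
  let D : Finset (Fin n → ℕ) := Finset.image₂ (· + ·) 𝓑 𝓑
  let r : ((Fin n → ℕ) → ℝ) →ₗ[ℝ] ({x // x ∈ D} → ℝ) := LinearMap.funLeft ℝ ℝ Subtype.val
  have hr : Continuous r := continuous_pi fun d => continuous_apply (d : Fin n → ℕ)
  refine isClosed_image_of_seminorm_eq_zero (LinearMap.toContinuousLinearMap (gramCoeff 𝓑))
    ((normSeminorm ℝ _).comp r) (continuous_norm.comp hr) (isClosed_patternCone B)
    (fun c hc Q hQ => smul_mem_patternCone hQ hc.le) fun Q hQ h => ?_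
  have h0 : r (gramCoeff 𝓑 Q) = 0 := norm_eq_zero.1 h
  refine eq_zero_of_gramCoeff_eq_zero hQ.1 (funext fun α => ?_)
  by_cases hα : α ∈ D
  · exact congrFun h0 ⟨α, hα⟩
  · rw [gramCoeff_apply]
    refine Finset.sum_eq_zero fun β _ => Finset.sum_eq_zero fun γ _ => if_neg fun h => hα ?_
    exact h ▸ Finset.mem_image₂_of_mem β.2 γ.2

/-- The cone of sums of squares with Gram matrix in `patternCone B`. -/
noncomputable def sosCone {n : ℕ} (𝓑 : Finset (Fin n → ℕ))
    (B : Matrix {x // x ∈ 𝓑} {x // x ∈ 𝓑} ℝ) : ProperCone ℝ ((Fin n → ℕ) → ℝ) where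
  carrier := gramCoeff 𝓑 '' patternCone B
  add_mem' := by
    rintro _ _ ⟨Q, hQ, rfl⟩ ⟨R, hR, rfl⟩
    exact ⟨Q + R, add_mem_patternCone hQ hR, map_add _ _ _⟩
  zero_mem' := ⟨0, ⟨Matrix.PosSemidef.zero, Matrix.hadamard_zero _⟩, map_zero _⟩
  smul_mem' := by
    rintro c _ ⟨Q, hQ, rfl⟩
    exact ⟨(c : ℝ) • Q, smul_mem_patternCone hQ c.2, map_smul _ _ _⟩
  isClosed' := isClosed_gramCoeff_image_patternCone 𝓑 B

theorem mem_sosCone {n : ℕ} {𝓑 : Finset (Fin n → ℕ)}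
    {B : Matrix {x // x ∈ 𝓑} {x // x ∈ 𝓑} ℝ} {g : (Fin n → ℕ) → ℝ} :
    g ∈ sosCone 𝓑 B ↔ g ∈ gramCoeff 𝓑 '' patternCone B := Iff.rfl

/-- Weak duality. -/
theorem le_riesz_of_mem {n : ℕ} {𝓑 : Finset (Fin n → ℕ)} {f : (Fin n → ℕ) →₀ ℝ}
    {B : Matrix {x // x ∈ 𝓑} {x // x ∈ 𝓑} ℝ} {lam : ℝ} {y : (Fin n → ℕ) → ℝ}
    (hlam : lam ∈ sosSet 𝓑 f B) (hy : y ∈ momentFeas 𝓑 B) : lam ≤ riesz f y := by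
  obtain ⟨Q, ⟨hQ, hBQ⟩, hf⟩ := mem_sosSet_iff.1 hlam
  have hg : gramCoeff 𝓑 Q = (f - Finsupp.single 0 lam : (Fin n → ℕ) →₀ ℝ) := by
    ext α
    simp [hf, Finsupp.single_apply, Pi.single_apply, eq_comm]
  have key := linearCombination_eq_of_gramCoeff hg y
  rw [map_sub, Finsupp.linearCombination_single, hy.1, smul_eq_mul, mul_one,
    ← riesz_eq_linearCombination] at key
  have hnonneg := hQ.sum_mul_nonneg hy.2
  have : ∀ β γ, Q β γ * (B ⊙ momentMatrix 𝓑 y) β γ =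
      Q β γ * y ((β : Fin n → ℕ) + γ) := fun β γ => by
    conv_rhs => rw [← hBQ]
    simp only [Matrix.hadamard_apply, momentMatrix, Matrix.of_apply]
    ring
  simp only [this] at hnonneg
  linarith

/-- The moments of the Dirac measure at the origin. -/
theorem single_mem_momentFeas {n : ℕ} (𝓑 : Finset (Fin n → ℕ))
    {B : Matrix {x // x ∈ 𝓑} {x // x ∈ 𝓑} ℝ} (hB : B.PosSemidef) :
    (Pi.single 0 1 : (Fin n → ℕ) → ℝ) ∈ momentFeas 𝓑 B := by
  refine ⟨by simp, hB.hadamard ?_⟩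
  let v : {x // x ∈ 𝓑} → ℝ := fun β => if (β : Fin n → ℕ) = 0 then 1 else 0
  have : momentMatrix 𝓑 (Pi.single 0 1) = Matrix.vecMulVec v (star v) := by
    ext β γ
    simp [momentMatrix, Matrix.vecMulVec_apply, Pi.single_apply, v, ite_and]
    split_ifs <;> rfl
  exact this ▸ Matrix.posSemidef_vecMulVec_self_star v

/-- A functional that is nonnegative on `sosCone 𝓑 B` has a positive semidefinite block moment
matrix. -/
theorem posSemidef_hadamard_momentMatrix {n : ℕ} {𝓑 : Finset (Fin n → ℕ)}
    {B : Matrix {x // x ∈ 𝓑} {x // x ∈ 𝓑} ℝ} (hB : B.PosSemidef) (hBB : B ⊙ B = B)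
    (L : ((Fin n → ℕ) → ℝ) →ₗ[ℝ] ℝ) (hL : ∀ g ∈ sosCone 𝓑 B, 0 ≤ L g) :
    (B ⊙ momentMatrix 𝓑 fun α => L (Pi.single α 1)).PosSemidef := by
  refine Matrix.PosSemidef.of_dotProduct_mulVec_nonneg ?_ fun v => ?_
  · ext β γ
    have := hB.isHermitian.apply β γ
    simp only [star_trivial] at this
    simp [momentMatrix, add_comm, this]
  · have hmem : B ⊙ Matrix.vecMulVec v (star v) ∈ patternCone B :=
      ⟨hB.hadamard (Matrix.posSemidef_vecMulVec_self_star v),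
        by rw [← Matrix.hadamard_assoc, hBB]⟩
    refine (hL _ ⟨_, hmem, rfl⟩).trans_eq ?_
    simp only [gramCoeff_eq_sum, map_sum, map_smul, dotProduct, Matrix.mulVec, Finset.mul_sum,
      Matrix.hadamard_apply, Matrix.vecMulVec_apply, momentMatrix, Matrix.of_apply, smul_eq_mul,
      Pi.star_apply, star_trivial]
    exact Finset.sum_congr rfl fun β _ => Finset.sum_congr rfl fun γ _ => by ring

/-- Strong duality: a value that is not feasible for the sums of squares program is beaten by some
feasible moment sequence. -/
theorem exists_riesz_lt_of_notMem {n : ℕ} {𝓑 : Finset (Fin n → ℕ)} (h0 : (0 : Fin n → ℕ) ∈ 𝓑)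
    {B : Matrix {x // x ∈ 𝓑} {x // x ∈ 𝓑} ℝ} (hB : B.PosSemidef) (hBB : B ⊙ B = B)
    (hB0 : B ⟨0, h0⟩ ⟨0, h0⟩ = 1) {f : (Fin n → ℕ) →₀ ℝ} {lam : ℝ} (hlam : lam ∉ sosSet 𝓑 f B) :
    ∃ y ∈ momentFeas 𝓑 B, riesz f y < lam := by
  rw [mem_sosSet_iff, ← mem_sosCone] at hlam
  obtain ⟨L, hL, hLf⟩ := ProperCone.hyperplane_separation_point _ hlam
  set y : (Fin n → ℕ) → ℝ := fun α => L (Pi.single α 1) with hy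
  have hLy : (B ⊙ momentMatrix 𝓑 y).PosSemidef :=
    posSemidef_hadamard_momentMatrix hB hBB L.toLinearMap hL
  have hy0 : 0 ≤ y 0 := by
    simpa [momentMatrix, hB0] using hLy.diag_nonneg (i := ⟨0, h0⟩)
  have hLr : L f = riesz f y := by
    have : (f : (Fin n → ℕ) → ℝ) = ∑ α ∈ f.support, f α • Pi.single α (1 : ℝ) := by
      ext α
      simp [Finset.sum_apply, Pi.single_apply]
    rw [this, map_sum]
    simp [riesz, hy]
  rw [map_sub, map_smul, smul_eq_mul, hLr, sub_neg] at hLf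
  change riesz f y < lam * y 0 at hLf
  -- Perturb by the Dirac moments to make the mass positive.
  obtain ⟨ε, hε, hlt⟩ : ∃ ε : ℝ, 0 < ε ∧
      riesz f y + ε * riesz f (Pi.single 0 1) < lam * (y 0 + ε) := by
    have hc : Filter.Tendsto
        (fun ε : ℝ => lam * (y 0 + ε) - (riesz f y + ε * riesz f (Pi.single 0 1)))
        (nhdsWithin 0 (Set.Ioi 0)) (nhds (lam * y 0 - riesz f y)) :=
      tendsto_nhdsWithin_of_tendsto_nhds (Continuous.tendsto' (by fun_prop) _ _ (by simp))
    obtain ⟨ε, h1, h2⟩ := ((hc.eventually_const_lt (sub_pos.2 hLf)).and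
      self_mem_nhdsWithin).exists
    exact ⟨ε, h2, sub_pos.1 h1⟩
  have hpos : 0 < y 0 + ε := by linarith
  refine ⟨(y 0 + ε)⁻¹ • (y + ε • Pi.single 0 1), ⟨by simp [hpos.ne'], ?_⟩, ?_⟩
  · have hD := (single_mem_momentFeas 𝓑 hB).2
    convert (hLy.add (hD.smul hε.le)).smul (inv_nonneg.2 hpos.le) using 1
    ext β γ
    simp [momentMatrix]
    ring
  · have : riesz f ((y 0 + ε)⁻¹ • (y + ε • Pi.single 0 1)) =
        (y 0 + ε)⁻¹ * (riesz f y + ε * riesz f (Pi.single 0 1)) := by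
      simp only [riesz, Finset.mul_sum, ← Finset.sum_add_distrib]
      exact Finset.sum_congr rfl fun α _ => by simp; ring
    rw [this, inv_mul_lt_iff₀ hpos]
    linarith

/-- Proposition 4.1: Let `𝓑 ⊆ ℕⁿ` be finite with `0 ∈ 𝓑`, `B`
the pattern of a partition of `𝓑`, and `f` a polynomial with
`supp(f) ⊆ 𝓑 + 𝓑`.  If the feasible set `Λ` of the sparse SOS program
`(P^τ)*` is nonempty, then `Λ` attains its supremum and
`sup Λ = inf{L_y(f) : y_0 = 1, B ∘ M_𝓑(y) PSD}`: `(P^τ)*` is solvable and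
there is no duality gap between `(P^τ)` and `(P^τ)*`. -/
theorem stmt_17 {n : ℕ} (𝓑 : Finset (Fin n → ℕ)) (h0 : (0 : Fin n → ℕ) ∈ 𝓑)
    (s : Setoid {x // x ∈ 𝓑}) (B : Matrix {x // x ∈ 𝓑} {x // x ∈ 𝓑} ℝ)
    (hB : ∀ β γ, B β γ = if s.r β γ then 1 else 0)
    (f : (Fin n → ℕ) →₀ ℝ)
    (hsupp : ∀ α ∈ f.support, ∃ β ∈ 𝓑, ∃ γ ∈ 𝓑, α = β + γ)
    (hne : (sosSet 𝓑 f B).Nonempty) :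
    sSup (sosSet 𝓑 f B) ∈ sosSet 𝓑 f B ∧
    sSup (sosSet 𝓑 f B) = sInf (riesz f '' momentFeas 𝓑 B) := by
  have hBpsd : B.PosSemidef := posSemidef_of_setoid s hB
  have hBB : B ⊙ B = B := by
    ext β γ
    simp [hB]
  have hB0 : B ⟨0, h0⟩ ⟨0, h0⟩ = 1 := by
    rw [hB, if_pos (s.refl _)]
  have hbdd : BddAbove (sosSet 𝓑 f B) :=
    ⟨_, fun _ hlam => le_riesz_of_mem hlam (single_mem_momentFeas 𝓑 hBpsd)⟩
  have hclosed : IsClosed (sosSet 𝓑 f B) := by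
    have : sosSet 𝓑 f B = (fun lam : ℝ => (f : (Fin n → ℕ) → ℝ) - lam • Pi.single 0 1) ⁻¹'
        (gramCoeff 𝓑 '' patternCone B) := Set.ext fun _ => mem_sosSet_iff
    rw [this]
    exact (isClosed_gramCoeff_image_patternCone 𝓑 B).preimage (by fun_prop)
  have hmem := hclosed.csSup_mem hne hbdd
  have hlower : ∀ t ∈ riesz f '' momentFeas 𝓑 B, sSup (sosSet 𝓑 f B) ≤ t := by
    rintro _ ⟨y, hy, rfl⟩
    exact le_riesz_of_mem hmem hy
  refine ⟨hmem, le_antisymm (le_csInf ⟨_, _, single_mem_momentFeas 𝓑 hBpsd, rfl⟩ hlower) ?_⟩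
  refine le_of_forall_gt fun lam hlam => ?_
  obtain ⟨y, hy, hlt⟩ := exists_riesz_lt_of_notMem h0 hBpsd hBB hB0
    fun h => hlam.not_ge (le_csSup hbdd h)
  exact (csInf_le ⟨_, hlower⟩ ⟨y, hy, rfl⟩).trans_lt hlt
end
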